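/- arXiv:1809.07756 — 3 statements merged into one kernel-verified Lean document; each statement's English description precedes it below -/
import Mathlib

section
/- Conditional laws given increasing σ-fields pass to almost sure limits under a weakly continuous kernel: Let 𝕏 and 𝕐 be metric spaces and let Λ be a probability kernel from 𝕐 to 𝕏 such that y ↦ Λ(y,·) is continuous for the topology of weak convergence of probability measures. Let (𝒢_n)_{n≥1} be an increasing sequence of sub-σ-fields of a probability space and 𝒢_∞ := σ(⋃_n 𝒢_n). Let X_n, X be 𝕏-valued and Y_n, Y be 𝕐-valued random elements with Y_n measurable with respect to 𝒢_n for each n, Y measurable with respect to 𝒢_∞, X_n → X almost surely and Y_n → Y almost surely. If ℙ(X_n ∈ A | 𝒢_n) = Λ(Y_n, A) almost surely for every n ≥ 1 and every Borel set A ⊆ 𝕏, then ℙ(X ∈ A | 𝒢_∞) = Λ(Y, A) almost surely for every Borel set A ⊆ 𝕏. -/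
open MeasureTheory Filter Set
open scoped NNReal

open scoped ENNReal BoundedContinuousFunction Topology

theorem Continuous.lintegral_probabilityMeasure
    {𝕐 𝕏 : Type*} [TopologicalSpace 𝕐] [TopologicalSpace 𝕏] [MeasurableSpace 𝕏]
    [OpensMeasurableSpace 𝕏] {Λ : 𝕐 → ProbabilityMeasure 𝕏} (hΛ : Continuous Λ) (f : 𝕏 →ᵇ ℝ≥0) :
    Continuous fun y => ∫⁻ x, f x ∂(Λ y : Measure 𝕏) :=
  continuous_iff_continuousAt.2 fun y =>
    ProbabilityMeasure.tendsto_iff_forall_lintegral_tendsto.1 (hΛ.tendsto y) f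

/-- A weakly continuous family of probability measures is a measurable kernel. -/
theorem Continuous.measurable_toMeasure_probabilityMeasure
    {𝕐 𝕏 : Type*} [TopologicalSpace 𝕐] [MeasurableSpace 𝕐] [OpensMeasurableSpace 𝕐]
    [TopologicalSpace 𝕏] [MeasurableSpace 𝕏] [BorelSpace 𝕏] [HasOuterApproxClosed 𝕏]
    {Λ : 𝕐 → ProbabilityMeasure 𝕏} (hΛ : Continuous Λ) :
    Measurable fun y => (Λ y : Measure 𝕏) := by
  refine Measurable.measure_of_isPiSystem_of_isProbabilityMeasure
    ((BorelSpace.measurable_eq (α := 𝕏)).trans borel_eq_generateFrom_isClosed)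
    isPiSystem_isClosed fun F hF => ?_
  refine measurable_of_tendsto_metrizable
    (fun n => (hΛ.lintegral_probabilityMeasure (IsClosed.apprSeq hF n)).measurable)
    (tendsto_pi_nhds.2 fun y => HasOuterApproxClosed.tendsto_lintegral_apprSeq hF _)

/-- A bounded `G`-measurable function is a version of the conditional probability of `S` given
`G` if and only if it integrates to `μ (B ∩ S)` over each `B ∈ G`. -/
theorem condExp_indicator_one_ae_eq_iff {Ω : Type*} {G m : MeasurableSpace Ω} {μ : Measure Ω}
    [IsFiniteMeasure μ] (hG : G ≤ m) {S : Set Ω} (hS : MeasurableSet S)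
    {p : Ω → ℝ≥0} (hp : Measurable[G] p) (hp_le : ∀ ω, p ω ≤ 1) :
    μ[S.indicator (fun _ => (1 : ℝ)) | G] =ᵐ[μ] (fun ω => (p ω : ℝ)) ↔
      ∀ B, MeasurableSet[G] B → ∫⁻ ω in B, p ω ∂μ = μ (B ∩ S) := by
  have hint : Integrable (S.indicator fun _ => (1 : ℝ)) μ := (integrable_const 1).indicator hS
  have hp_int : Integrable (fun ω => (p ω : ℝ)) μ :=
    .of_bound (hp.mono hG le_rfl).coe_nnreal_real.aestronglyMeasurable 1
      (ae_of_all _ fun ω => by simpa using hp_le ω)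
  have key (B : Set Ω) :
      ∫⁻ ω in B, p ω ∂μ = μ (B ∩ S) ↔
        ∫ ω in B, (p ω : ℝ) ∂μ = ∫ ω in B, S.indicator (fun _ => (1 : ℝ)) ω ∂μ := by
    rw [lintegral_coe_eq_integral _ hp_int.integrableOn, setIntegral_indicator hS,
      setIntegral_const, smul_eq_mul, mul_one, ← ofReal_measureReal,
      ENNReal.ofReal_eq_ofReal_iff (integral_nonneg fun ω => (p ω).coe_nonneg) measureReal_nonneg]
  refine ⟨fun h B hB => (key B).2 ?_, fun h => ?_⟩
  · rw [← setIntegral_condExp hG hint hB]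
    exact setIntegral_congr_ae (hG B hB) (h.mono fun ω hω _ => hω.symm)
  · exact (ae_eq_condExp_of_forall_setIntegral_eq hG hint
      (fun _ _ _ => hp_int.integrableOn) (fun B hB _ => (key B).1 (h B hB))
      hp.coe_nnreal_real.stronglyMeasurable.aestronglyMeasurable).symm

/-- **Conditional laws given increasing σ-fields pass to almost sure limits under a weakly
continuous kernel.**  `Λ` is a probability kernel from the metric space `𝕐` to the metric
space `𝕏`, continuous for the topology of weak convergence; `(G n)` is an increasing sequence
of sub-σ-fields of the ambient σ-field `m`, with `𝒢_∞ = ⨆ n, G n`; `Xn → X` and `Yn → Y`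
almost surely, `Yn n` is `G n`-measurable and `Y` is `𝒢_∞`-measurable.  If the conditional
law of `Xn n` given `G n` is `Λ(Yn n, ·)` for every `n`, then the conditional law of `X`
given `𝒢_∞` is `Λ(Y, ·)` (conditional laws expressed via conditional expectations of
indicator functions). -/
theorem conditional_law_limit_of_weakly_continuous_kernel
    {Ω : Type*} [m : MeasurableSpace Ω] {μ : Measure Ω} [IsProbabilityMeasure μ]
    {𝕏 : Type*} [MetricSpace 𝕏] [MeasurableSpace 𝕏] [BorelSpace 𝕏]
    {𝕐 : Type*} [MetricSpace 𝕐] [MeasurableSpace 𝕐] [BorelSpace 𝕐]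
    (Λ : 𝕐 → ProbabilityMeasure 𝕏) (hΛ : Continuous Λ)
    (G : ℕ → MeasurableSpace Ω) (hG_le : ∀ n, G n ≤ m) (hG_mono : Monotone G)
    (Xn : ℕ → Ω → 𝕏) (X : Ω → 𝕏) (Yn : ℕ → Ω → 𝕐) (Y : Ω → 𝕐)
    (hXn_meas : ∀ n, Measurable (Xn n)) (hX_meas : Measurable X)
    (hYn_meas : ∀ n, Measurable[G n] (Yn n)) (hY_meas : Measurable[⨆ n, G n] Y)
    (hX_conv : ∀ᵐ ω ∂μ, Tendsto (fun n => Xn n ω) atTop (nhds (X ω)))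
    (hY_conv : ∀ᵐ ω ∂μ, Tendsto (fun n => Yn n ω) atTop (nhds (Y ω)))
    (hcond : ∀ n, ∀ A : Set 𝕏, MeasurableSet A →
      μ[fun ω => A.indicator (fun _ => (1 : ℝ)) (Xn n ω) | G n]
        =ᵐ[μ] fun ω => ((Λ (Yn n ω) A : ℝ≥0) : ℝ)) :
    ∀ A : Set 𝕏, MeasurableSet A →
      μ[fun ω => A.indicator (fun _ => (1 : ℝ)) (X ω) | ⨆ n, G n]
        =ᵐ[μ] fun ω => ((Λ (Y ω) A : ℝ≥0) : ℝ) := by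
  have hΛm := hΛ.measurable_toMeasure_probabilityMeasure
  have hGs : (⨆ n, G n) ≤ m := iSup_le hG_le
  have hYm : Measurable Y := hY_meas.mono hGs le_rfl
  have hYnm (n : ℕ) : Measurable (Yn n) := (hYn_meas n).mono (hG_le n) le_rfl
  have hΛY : Measurable fun ω => (Λ (Y ω) : Measure 𝕏) := hΛm.comp hYm
  have hΛYn (n : ℕ) : Measurable fun ω => (Λ (Yn n ω) : Measure 𝕏) := hΛm.comp (hYnm n)
  have hΛA {A : Set 𝕏} (hA : MeasurableSet A) : Measurable fun y => Λ y A :=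
    ((Measure.measurable_coe hA).comp hΛm).ennreal_toNNReal
  have joint_n {k n : ℕ} (hkn : k ≤ n) {B : Set Ω} (hB : MeasurableSet[G k] B) :
      (μ.restrict B).map (Xn n) = (μ.restrict B).bind fun ω => (Λ (Yn n ω) : Measure 𝕏) := by
    ext A hA
    rw [Measure.map_apply (hXn_meas n) hA, Measure.restrict_apply (hXn_meas n hA),
      Measure.bind_apply hA (hΛYn n).aemeasurable, inter_comm]
    simpa using ((condExp_indicator_one_ae_eq_iff (hG_le n) (hXn_meas n hA)
      ((hΛA hA).comp (hYn_meas n)) fun ω => (Λ (Yn n ω)).apply_le_one A).1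
      (hcond n A hA) B (hG_mono hkn B hB)).symm
  have joint {k : ℕ} {B : Set Ω} (hB : MeasurableSet[G k] B) :
      (μ.restrict B).map X = (μ.restrict B).bind fun ω => (Λ (Y ω) : Measure 𝕏) := by
    refine ext_of_forall_lintegral_eq_of_IsFiniteMeasure fun f => ?_
    have hf : Measurable fun x => (f x : ℝ≥0∞) := f.continuous.measurable.coe_nnreal_ennreal
    have hc := hΛ.lintegral_probabilityMeasure f
    have hle (x : 𝕏) : (f x : ℝ≥0∞) ≤ nndist f 0 :=
      ENNReal.coe_le_coe.2 (BoundedContinuousFunction.NNReal.upper_bound f x)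
    have hfin : ∫⁻ _, (nndist f 0 : ℝ≥0∞) ∂μ.restrict B ≠ ∞ :=
      (lintegral_const_lt_top ENNReal.coe_ne_top).ne
    rw [lintegral_map hf hX_meas,
      Measure.lintegral_bind hΛY.aemeasurable hf.aemeasurable]
    have lim_X : Tendsto (fun n => ∫⁻ ω in B, f (Xn n ω) ∂μ) atTop
        (𝓝 (∫⁻ ω in B, f (X ω) ∂μ)) :=
      tendsto_lintegral_of_dominated_convergence _ (fun n => hf.comp (hXn_meas n))
        (fun n => ae_of_all _ fun ω => hle _) hfin
        (ae_restrict_of_ae (hX_conv.mono fun ω hω =>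
          ((ENNReal.continuous_coe.comp f.continuous).tendsto _).comp hω))
    have lim_Y : Tendsto (fun n => ∫⁻ ω in B, ∫⁻ x, f x ∂(Λ (Yn n ω) : Measure 𝕏) ∂μ) atTop
        (𝓝 (∫⁻ ω in B, ∫⁻ x, f x ∂(Λ (Y ω) : Measure 𝕏) ∂μ)) :=
      tendsto_lintegral_of_dominated_convergence _ (fun n => hc.measurable.comp (hYnm n))
        (fun n => ae_of_all _ fun ω => (lintegral_mono hle).trans (by simp)) hfin
        (ae_restrict_of_ae (hY_conv.mono fun ω hω => (hc.tendsto _).comp hω))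
    refine tendsto_nhds_unique (lim_X.congr' ?_) lim_Y
    filter_upwards [eventually_ge_atTop k] with n hkn
    rw [← lintegral_map hf (hXn_meas n), joint_n hkn hB,
      Measure.lintegral_bind (hΛYn n).aemeasurable hf.aemeasurable]
  intro A hA
  refine (condExp_indicator_one_ae_eq_iff hGs (hX_meas hA) ((hΛA hA).comp hY_meas)
    fun ω => (Λ (Y ω)).apply_le_one A).2 fun B hB => ?_
  have on_G {k : ℕ} {B : Set Ω} (hB : MeasurableSet[G k] B) :
      μ.restrict (X ⁻¹' A) B = μ.withDensity (fun ω => (Λ (Y ω) : Measure 𝕏) A) B := by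
    have h := congrArg (fun ν => ν A) (joint hB)
    simp only [Measure.map_apply hX_meas hA, Measure.restrict_apply (hX_meas hA),
      Measure.bind_apply hA hΛY.aemeasurable] at h
    rw [Measure.restrict_apply (hG_le k B hB), withDensity_apply _ (hG_le k B hB), inter_comm, h]
  have h := ext_on_measurableSpace_of_generate_finite m (⋃ n, {t | MeasurableSet[G n] t})
    (fun s hs => let ⟨_, hk⟩ := mem_iUnion.1 hs; on_G hk) hGs
    (MeasurableSpace.generateFrom_iUnion_measurableSet G).symm
    (isPiSystem_iUnion_of_monotone _ (fun n => (G n).isPiSystem_measurableSet)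
      fun i j hij => hG_mono hij) (on_G (k := 0) MeasurableSet.univ) hB
  rw [Measure.restrict_apply (hGs B hB), withDensity_apply _ (hGs B hB)] at h
  simpa using h.symm
end

section
/- Injectivity of the relabelling map and well-definedness of the swap-and-reduce map on tree shapes: Let A ⊆ ℕ be finite with #A ≥ 2, let 𝐭 ∈ 𝕋^shape_A, i ∈ A and j := J(𝐭,i). Then j ∈ A and j is not the minimum of A. For E ⊆ A let φ_{𝐭,i}(E) be the set obtained from E by first deleting i and then replacing j by i (if present). Then: (a) for all E_1, E_2 ∈ 𝐭, φ_{𝐭,i}(E_1) = φ_{𝐭,i}(E_2) if and only if E_1∖{i} = E_2∖{i}; (b) the only pair of distinct edges E_1 ≠ E_2 of 𝐭 with E_1∖{i} = E_2∖{i} is the pair consisting of the parent of the leaf edge {i} and the sibling of {i}, and such a pair exists only when this sibling is an internal edge; consequently φ_{𝐭,i} restricted to 𝐭 ∖ {parent({i})} is injective; and (c) its image ϱ̃(𝐭,i) := φ_{𝐭,i}(𝐭 ∖ {parent({i})}) is a tree shape with label set A∖{j}, i.e. ϱ̃(𝐭,i) ∈ 𝕋^shape_{A∖{j}}. -/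
open scoped Classical

namespace AldousTrees

/-- The edges of a tree shape with label set `A`: the internal edges in `t` together with the
leaf edges `{a}`, `a ∈ A`. -/
def edges (A : Finset ℕ) (t : Finset (Finset ℕ)) : Finset (Finset ℕ) :=
  t ∪ A.image fun a => ({a} : Finset ℕ)

/-- `C` is a child of `E`: a maximal proper member of `edges A t` contained in `E`. -/
def IsChild (A : Finset ℕ) (t : Finset (Finset ℕ)) (C E : Finset ℕ) : Prop :=
  C ∈ edges A t ∧ C ⊂ E ∧ ∀ F ∈ edges A t, C ⊂ F → ¬ F ⊂ E

/-- `t` is (the edge-set representation of) a tree shape with label set `A`: a rooted binary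
combinatorial tree with leaves labelled by `A` and root of degree one.  `t` is the collection
of internal edges, each represented by the set of leaf labels above it. -/
structure IsTreeShape (A : Finset ℕ) (t : Finset (Finset ℕ)) : Prop where
  nonempty_ground : A.Nonempty
  subset_ground : ∀ E ∈ t, E ⊆ A
  two_le_card : ∀ E ∈ t, 2 ≤ E.card
  ground_mem : 2 ≤ A.card → A ∈ t
  nested_or_disjoint : ∀ E ∈ edges A t, ∀ F ∈ edges A t, E ⊆ F ∨ F ⊆ E ∨ Disjoint E F
  binary : ∀ E ∈ t, ∃ C₁ C₂, IsChild A t C₁ E ∧ IsChild A t C₂ E ∧ C₁ ≠ C₂ ∧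
    Disjoint C₁ C₂ ∧ C₁ ∪ C₂ = E ∧ ∀ C, IsChild A t C E → C = C₁ ∨ C = C₂

/-- The number of children of the internal edge `E` that are leaf edges; an internal edge is of
type `d` if exactly `d` of its two children are leaf edges. -/
noncomputable def leafChildCount (A : Finset ℕ) (t : Finset (Finset ℕ)) (E : Finset ℕ) : ℕ :=
  ((A.image fun a => ({a} : Finset ℕ)).filter fun C => IsChild A t C E).card

end AldousTrees

namespace AldousTrees

/-- `P` is the parent of the edge `E` in `t`: `P = ⋂ {F ∈ t : E ⊊ F}`, equivalently the
least internal edge strictly containing `E`. -/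
def IsParent (A : Finset ℕ) (t : Finset (Finset ℕ)) (E P : Finset ℕ) : Prop :=
  P ∈ t ∧ E ⊂ P ∧ ∀ F ∈ t, E ⊂ F → P ⊆ F

/-- `S` is the sibling of the edge `E`: the other child of the parent of `E`. -/
def IsSibling (A : Finset ℕ) (t : Finset (Finset ℕ)) (E S : Finset ℕ) : Prop :=
  ∃ P, IsParent A t E P ∧ IsChild A t S P ∧ S ≠ E

/-- The smallest label of an edge (`0` for the empty set). -/
noncomputable def minLabel (E : Finset ℕ) : ℕ := sInf (E : Set ℕ)

/-- The relabelling map `φ_{𝐭,i}`: from a label set, first delete `i`, then replace `j`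
by `i` (if present). -/
def relabel (i j : ℕ) (E : Finset ℕ) : Finset ℕ :=
  if j ∈ E.erase i then insert i ((E.erase i).erase j) else E.erase i

theorem mem_edges {A : Finset ℕ} {t : Finset (Finset ℕ)} {E : Finset ℕ} :
    E ∈ edges A t ↔ E ∈ t ∨ ∃ a ∈ A, {a} = E := by
  simp [edges]

/-- An edge with at least two labels is internal. -/
theorem mem_of_mem_edges {A : Finset ℕ} {t : Finset (Finset ℕ)} {E : Finset ℕ}
    (hE : E ∈ edges A t) (h2 : 2 ≤ E.card) : E ∈ t := by
  rcases mem_edges.1 hE with h | ⟨a, ha, rfl⟩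
  · exact h
  · simp at h2

/-- A leaf edge is a child of its parent. -/
theorem isChild_singleton_of_isParent {A : Finset ℕ} {t : Finset (Finset ℕ)} {i : ℕ} {P : Finset ℕ}
    (hi : i ∈ A) (hP : IsParent A t {i} P) : IsChild A t {i} P := by
  refine ⟨mem_edges.2 (Or.inr ⟨i, hi, rfl⟩), hP.2.1, fun F hF hiF hFP => hFP.2 (hP.2.2 F ?_ hiF)⟩
  have := Finset.card_lt_card hiF
  rw [Finset.card_singleton] at this
  exact mem_of_mem_edges hF this

namespace IsTreeShape

variable {A : Finset ℕ} {t : Finset (Finset ℕ)}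

theorem nonempty_of_mem_edges (ht : IsTreeShape A t) {E : Finset ℕ} (hE : E ∈ edges A t) :
    E.Nonempty := by
  rcases mem_edges.1 hE with h | ⟨a, -, rfl⟩
  · have := ht.two_le_card E h
    exact Finset.card_pos.1 (by omega)
  · exact Finset.singleton_nonempty a

theorem subset_of_mem_edges (ht : IsTreeShape A t) {E : Finset ℕ} (hE : E ∈ edges A t) :
    E ⊆ A := by
  rcases mem_edges.1 hE with h | ⟨a, ha, rfl⟩
  · exact ht.subset_ground E h
  · simpa using ha

/-- To check that every internal edge has exactly two children, it suffices to split it into two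
disjoint edges. -/
theorem of_split (hA : A.Nonempty) (hsub : ∀ E ∈ t, E ⊆ A) (hcard : ∀ E ∈ t, 2 ≤ E.card)
    (hground : 2 ≤ A.card → A ∈ t)
    (hnest : ∀ E ∈ edges A t, ∀ F ∈ edges A t, E ⊆ F ∨ F ⊆ E ∨ Disjoint E F)
    (hsplit : ∀ E ∈ t, ∃ C₁ ∈ edges A t, ∃ C₂ ∈ edges A t, Disjoint C₁ C₂ ∧ C₁ ∪ C₂ = E) :
    IsTreeShape A t := by
  have hne : ∀ E ∈ edges A t, E.Nonempty := by
    intro E hE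
    rcases mem_edges.1 hE with h | ⟨a, -, rfl⟩
    · have := hcard E h
      exact Finset.card_pos.1 (by omega)
    · exact Finset.singleton_nonempty a
  have ssub : ∀ C₁, ∀ C₂ ∈ edges A t, Disjoint C₁ C₂ → C₁ ⊂ C₁ ∪ C₂ := by
    intro C₁ C₂ h₂ hd
    obtain ⟨x, hx⟩ := hne C₂ h₂
    refine Finset.ssubset_iff_subset_ne.2 ⟨Finset.subset_union_left, fun h => ?_⟩
    have : x ∈ C₁ := h ▸ Finset.mem_union_right _ hx
    exact Finset.disjoint_left.1 hd this hx
  have child : ∀ C₁ ∈ edges A t, ∀ C₂ ∈ edges A t, Disjoint C₁ C₂ →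
      IsChild A t C₁ (C₁ ∪ C₂) := by
    intro C₁ h₁ C₂ h₂ hd
    refine ⟨h₁, ssub C₁ C₂ h₂ hd, fun F hF h1F hFE => ?_⟩
    obtain ⟨x, hx⟩ := hne C₁ h₁
    obtain ⟨y, hyF, hy⟩ := Finset.exists_of_ssubset h1F
    have hy₂ : y ∈ C₂ := (Finset.mem_union.1 (hFE.1 hyF)).resolve_left hy
    rcases hnest F hF C₂ h₂ with h | h | h
    · exact Finset.disjoint_left.1 hd hx (h (h1F.1 hx))
    · exact hFE.2 (Finset.union_subset h1F.1 h)
    · exact Finset.disjoint_left.1 h hyF hy₂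
  refine ⟨hA, hsub, hcard, hground, hnest, fun E hE => ?_⟩
  obtain ⟨C₁, h₁, C₂, h₂, hd, rfl⟩ := hsplit E hE
  have c₁ := child C₁ h₁ C₂ h₂ hd
  have c₂ : IsChild A t C₂ (C₁ ∪ C₂) := Finset.union_comm C₂ C₁ ▸ child C₂ h₂ C₁ h₁ hd.symm
  refine ⟨C₁, C₂, c₁, c₂, ?_, hd, rfl, fun C hC => ?_⟩
  · rintro rfl
    exact (hne C₁ h₁).ne_empty (by simpa using hd)
  have eq_of_meet : ∀ D, IsChild A t D (C₁ ∪ C₂) → ¬ Disjoint C D → C = D := by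
    intro D hD hCD
    by_contra hne'
    rcases hnest C hC.1 D hD.1 with h | h | h
    · exact hC.2.2 D hD.1 (Finset.ssubset_iff_subset_ne.2 ⟨h, hne'⟩) hD.2.1
    · exact hD.2.2 C hC.1 (Finset.ssubset_iff_subset_ne.2 ⟨h, Ne.symm hne'⟩) hC.2.1
    · exact hCD h
  obtain ⟨x, hx⟩ := hne C hC.1
  rcases Finset.mem_union.1 (hC.2.1.1 hx) with h | h
  · exact Or.inl (eq_of_meet C₁ c₁ fun hd' => Finset.disjoint_left.1 hd' hx h)
  · exact Or.inr (eq_of_meet C₂ c₂ fun hd' => Finset.disjoint_left.1 hd' hx h)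

/-- Tree shapes are stable under relabelling by a permutation of the labels. -/
theorem map_equiv (ht : IsTreeShape A t) (σ : Equiv.Perm ℕ) :
    IsTreeShape (A.map σ.toEmbedding) (t.image fun E => E.map σ.toEmbedding) := by
  have hedge : ∀ E, E ∈ edges (A.map σ.toEmbedding) (t.image fun E => E.map σ.toEmbedding) ↔
      ∃ F ∈ edges A t, F.map σ.toEmbedding = E := by
    intro E
    simp only [mem_edges, Finset.mem_image, Finset.mem_map, or_and_right, exists_or]
    refine or_congr Iff.rfl ⟨?_, ?_⟩
    · rintro ⟨_, ⟨a, ha, rfl⟩, rfl⟩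
      exact ⟨{a}, ⟨a, ha, rfl⟩, by simp⟩
    · rintro ⟨_, ⟨a, ha, rfl⟩, rfl⟩
      exact ⟨σ a, ⟨a, ha, rfl⟩, by simp⟩
  refine of_split (ht.nonempty_ground.map) ?_ ?_ ?_ ?_ ?_
  · simpa using ht.subset_ground
  · simpa using ht.two_le_card
  · intro h
    exact Finset.mem_image_of_mem _ (ht.ground_mem (by simpa using h))
  · intro E' hE' F' hF'
    obtain ⟨E, hE, rfl⟩ := (hedge E').1 hE'
    obtain ⟨F, hF, rfl⟩ := (hedge F').1 hF'
    simpa using ht.nested_or_disjoint E hE F hF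
  · intro E' hE'
    obtain ⟨E, hE, rfl⟩ := Finset.mem_image.1 hE'
    obtain ⟨C₁, C₂, h₁, h₂, -, hd, rfl, -⟩ := ht.binary E hE
    exact ⟨_, (hedge _).2 ⟨C₁, h₁.1, rfl⟩, _, (hedge _).2 ⟨C₂, h₂.1, rfl⟩, by simpa using hd,
      (Finset.map_union _ _).symm⟩

variable {i : ℕ} {P S : Finset ℕ}

/-- The parent of a leaf edge is the disjoint union of the leaf and its sibling. -/
theorem sibling_spec (ht : IsTreeShape A t) (hi : i ∈ A) (hP : IsParent A t {i} P)
    (hS : IsChild A t S P) (hSne : S ≠ {i}) : i ∉ S ∧ insert i S = P := by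
  obtain ⟨C₁, C₂, h₁, h₂, -, hd, rfl, hC⟩ := ht.binary P hP.1
  rcases hC _ (isChild_singleton_of_isParent hi hP) with rfl | rfl <;>
    rcases hC _ hS with rfl | rfl
  · exact absurd rfl hSne
  · exact ⟨by simpa using hd, rfl⟩
  · exact ⟨by simpa using hd, by rw [Finset.union_comm]; rfl⟩
  · exact absurd rfl hSne

theorem parent_subset (ht : IsTreeShape A t) (hP : IsParent A t {i} P) {E : Finset ℕ}
    (hE : E ∈ t) (hiE : i ∈ E) : P ⊆ E := by
  refine hP.2.2 E hE (Finset.ssubset_iff_subset_ne.2 ⟨by simpa using hiE, ?_⟩)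
  rintro rfl
  simpa using ht.two_le_card _ hE

/-- Deleting a leaf, and with it the parent of the leaf edge, gives a tree shape. -/
theorem erase_leaf (ht : IsTreeShape A t) (hi : i ∈ A) (hP : IsParent A t {i} P)
    (hS : IsChild A t S P) (hSne : S ≠ {i}) :
    IsTreeShape (A.erase i) ((t.erase P).image fun E => E.erase i) := by
  obtain ⟨hiS, hSP⟩ := ht.sibling_spec hi hP hS hSne
  have hPS : P.erase i = S := by rw [← hSP, Finset.erase_insert hiS]
  have hSneP : S ≠ P := hS.2.1.ne
  have hSe : S.erase i = S := Finset.erase_eq_of_notMem hiS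
  have mem_of_ne : ∀ C ∈ edges A t, C ≠ P → C ≠ {i} →
      C.erase i ∈ edges (A.erase i) ((t.erase P).image fun E => E.erase i) := by
    intro C hC hCP hCi
    rcases mem_edges.1 hC with h | ⟨a, ha, rfl⟩
    · exact mem_edges.2 (Or.inl (Finset.mem_image_of_mem _ (Finset.mem_erase.2 ⟨hCP, h⟩)))
    · have hai : a ≠ i := by rintro rfl; exact hCi rfl
      refine mem_edges.2 (Or.inr ⟨a, Finset.mem_erase.2 ⟨hai, ha⟩, ?_⟩)
      exact (Finset.erase_eq_of_notMem (by simpa using hai.symm)).symm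
  have erase_mem : ∀ C ∈ edges A t, C ≠ {i} →
      C.erase i ∈ edges (A.erase i) ((t.erase P).image fun E => E.erase i) := by
    intro C hC hCi
    by_cases hCP : C = P
    · rw [hCP, hPS, ← hSe]
      exact mem_of_ne S hS.1 hSneP hSne
    · exact mem_of_ne C hC hCP hCi
  have exists_of_mem : ∀ E ∈ edges (A.erase i) ((t.erase P).image fun E => E.erase i),
      ∃ C ∈ edges A t, C.erase i = E := by
    intro E hE
    rcases mem_edges.1 hE with h | ⟨a, ha, rfl⟩
    · obtain ⟨C, hC, rfl⟩ := Finset.mem_image.1 h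
      exact ⟨C, mem_edges.2 (Or.inl (Finset.mem_of_mem_erase hC)), rfl⟩
    · obtain ⟨hai, ha⟩ := Finset.mem_erase.1 ha
      exact ⟨{a}, mem_edges.2 (Or.inr ⟨a, ha, rfl⟩),
        Finset.erase_eq_of_notMem (by simpa using hai.symm)⟩
  refine of_split ?_ ?_ ?_ ?_ ?_ ?_
  · obtain ⟨x, hx⟩ := ht.nonempty_of_mem_edges hS.1
    exact ⟨x, Finset.mem_erase.2 ⟨fun h => hiS (h ▸ hx), ht.subset_of_mem_edges hS.1 hx⟩⟩
  · intro E hE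
    obtain ⟨C, hC, rfl⟩ := Finset.mem_image.1 hE
    exact Finset.erase_subset_erase _ (ht.subset_ground C (Finset.mem_of_mem_erase hC))
  · intro E hE
    obtain ⟨C, hC, rfl⟩ := Finset.mem_image.1 hE
    obtain ⟨hCP, hC⟩ := Finset.mem_erase.1 hC
    by_cases hiC : i ∈ C
    · have hlt := Finset.card_lt_card
        (Finset.ssubset_iff_subset_ne.2 ⟨ht.parent_subset hP hC hiC, Ne.symm hCP⟩)
      have h2 := ht.two_le_card P hP.1
      rw [Finset.card_erase_of_mem hiC]
      omega
    · rw [Finset.erase_eq_of_notMem hiC]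
      exact ht.two_le_card C hC
  · intro h2
    by_cases hAP : A = P
    · subst hAP
      rw [hPS] at h2 ⊢
      exact Finset.mem_image.2
        ⟨S, Finset.mem_erase.2 ⟨hSneP, mem_of_mem_edges hS.1 h2⟩, hSe⟩
    · exact Finset.mem_image_of_mem _ (Finset.mem_erase.2
        ⟨hAP, ht.ground_mem (h2.trans (Finset.card_le_card (Finset.erase_subset _ _)))⟩)
  · intro E' hE' F' hF'
    obtain ⟨E, hE, rfl⟩ := exists_of_mem E' hE'
    obtain ⟨F, hF, rfl⟩ := exists_of_mem F' hF'
    rcases ht.nested_or_disjoint E hE F hF with h | h | h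
    · exact Or.inl (Finset.erase_subset_erase _ h)
    · exact Or.inr (Or.inl (Finset.erase_subset_erase _ h))
    · exact Or.inr (Or.inr (h.mono (Finset.erase_subset _ _) (Finset.erase_subset _ _)))
  · intro E' hE'
    obtain ⟨E, hEt, rfl⟩ := Finset.mem_image.1 hE'
    obtain ⟨hEP, hE⟩ := Finset.mem_erase.1 hEt
    obtain ⟨C₁, C₂, h₁, h₂, -, hd, hU, -⟩ := ht.binary E hE
    have hne : ∀ C, IsChild A t C E → C ≠ {i} := by
      rintro _ hC rfl
      have hPE := ht.parent_subset hP hE (by simpa using hC.2.1.1)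
      exact hC.2.2 P (mem_edges.2 (Or.inl hP.1)) hP.2.1
        (Finset.ssubset_iff_subset_ne.2 ⟨hPE, Ne.symm hEP⟩)
    refine ⟨_, erase_mem C₁ h₁.1 (hne _ h₁), _, erase_mem C₂ h₂.1 (hne _ h₂),
      hd.mono (Finset.erase_subset _ _) (Finset.erase_subset _ _), ?_⟩
    rw [← hU, Finset.erase_union_distrib]

/-- Two distinct internal edges which agree after deleting `i`, the first one containing `i`, are
the parent and the sibling of `{i}`. -/
theorem eq_parent_sibling (ht : IsTreeShape A t) (hi : i ∈ A) (hP : IsParent A t {i} P)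
    (hS : IsChild A t S P) (hSne : S ≠ {i}) {E F : Finset ℕ} (hE : E ∈ t) (hF : F ∈ t)
    (hiE : i ∈ E) (hiF : i ∉ F) (h : E.erase i = F.erase i) : E = P ∧ F = S := by
  obtain ⟨hiS, hSP⟩ := ht.sibling_spec hi hP hS hSne
  have hEF : E = insert i F := by
    rw [← Finset.erase_eq_of_notMem hiF, ← h, Finset.insert_erase hiE]
  have hPE := ht.parent_subset hP hE hiE
  have hSF : S ⊆ F := by
    intro x hx
    have hxE : x ∈ insert i F := hEF ▸ hPE (hSP ▸ Finset.mem_insert_of_mem hx)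
    exact (Finset.mem_insert.1 hxE).resolve_left fun hxi => hiS (hxi ▸ hx)
  obtain ⟨x, hx⟩ := ht.nonempty_of_mem_edges hS.1
  have hFS : F = S := by
    rcases ht.nested_or_disjoint F (mem_edges.2 (Or.inl hF)) P (mem_edges.2 (Or.inl hP.1)) with
      hn | hn | hn
    · refine Finset.Subset.antisymm (fun y hy => ?_) hSF
      have hyP : y ∈ insert i S := hSP ▸ hn hy
      exact (Finset.mem_insert.1 hyP).resolve_left fun hyi => hiF (hyi ▸ hy)
    · exact absurd (hn (hSP ▸ Finset.mem_insert_self i S)) hiF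
    · exact absurd (hSP ▸ Finset.mem_insert_of_mem hx) (Finset.disjoint_left.1 hn (hSF hx))
  exact ⟨by rw [hEF, hFS, hSP], hFS⟩

end IsTreeShape

theorem minLabel_mem {E : Finset ℕ} (hE : E.Nonempty) : minLabel E ∈ E :=
  Finset.mem_coe.1 (Nat.sInf_mem (s := (E : Set ℕ)) hE)

theorem minLabel_le {E : Finset ℕ} {x : ℕ} (hx : x ∈ E) : minLabel E ≤ x :=
  Nat.sInf_le (Finset.mem_coe.2 hx)

/-- The relabelling map is deletion of `i` followed by the transposition of `i` and `j`. -/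
theorem relabel_eq_map_swap (i j : ℕ) (E : Finset ℕ) :
    relabel i j E = (E.erase i).map (Equiv.swap i j).toEmbedding := by
  ext x
  rw [Finset.mem_map_equiv, Equiv.symm_swap, Equiv.swap_apply_def, relabel]
  split_ifs <;> grind

/-- **Injectivity of the relabelling map and well-definedness of the swap-and-reduce map on
tree shapes.** Here `P` is the parent of the leaf edge `{i}`, `S` its sibling,
`a = minLabel S`, `b` is the smallest label of the uncle of `{i}` (`b = 0` if `P = A`), and
`j = J(𝐭,i) = max {i, a, b}`.  Then `j ∈ A` is not the minimum of `A`; `φ_{𝐭,i}` identifies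
two internal edges iff they agree after deleting `i`; the only such distinct pair is the
parent and the sibling of `{i}` (which then has to be an internal edge); `φ_{𝐭,i}` is
injective on `𝐭 ∖ {parent({i})}`; and its image is a tree shape with label set `A ∖ {j}`. -/
theorem swap_and_reduce_well_defined (A : Finset ℕ) (hA : 2 ≤ A.card)
    (t : Finset (Finset ℕ)) (ht : IsTreeShape A t) (i : ℕ) (hi : i ∈ A)
    (P : Finset ℕ) (hP : IsParent A t {i} P)
    (S : Finset ℕ) (hS : IsChild A t S P) (hSne : S ≠ {i})
    (b : ℕ)
    (hb : (P = A ∧ b = 0) ∨ (P ≠ A ∧ ∃ U, IsSibling A t P U ∧ b = minLabel U))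
    (j : ℕ) (hj : j = max i (max (minLabel S) b)) :
    (j ∈ A ∧ j ≠ minLabel A) ∧
    (∀ E₁ ∈ t, ∀ E₂ ∈ t,
      (relabel i j E₁ = relabel i j E₂ ↔ E₁.erase i = E₂.erase i)) ∧
    (∀ E₁ ∈ t, ∀ E₂ ∈ t, E₁ ≠ E₂ → E₁.erase i = E₂.erase i →
      S ∈ t ∧ ((E₁ = P ∧ E₂ = S) ∨ (E₁ = S ∧ E₂ = P))) ∧
    Set.InjOn (relabel i j) ↑(t.erase P) ∧
    IsTreeShape (A.erase j) ((t.erase P).image (relabel i j)) := by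
  have hmapinj := Finset.map_injective (Equiv.swap i j).toEmbedding
  have hrel : ∀ E₁ E₂, relabel i j E₁ = relabel i j E₂ ↔ E₁.erase i = E₂.erase i := by
    intro E₁ E₂
    rw [relabel_eq_map_swap, relabel_eq_map_swap, hmapinj.eq_iff]
  have hiS := (ht.sibling_spec hi hP hS hSne).1
  have haS := minLabel_mem (ht.nonempty_of_mem_edges hS.1)
  have haA := ht.subset_of_mem_edges hS.1 haS
  have hai : minLabel S ≠ i := fun h => hiS (h ▸ haS)
  have hbA : b = 0 ∨ b ∈ A := by
    rcases hb with ⟨-, rfl⟩ | ⟨-, U, ⟨Q, -, hU, -⟩, rfl⟩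
    · exact Or.inl rfl
    · exact Or.inr (ht.subset_of_mem_edges hU.1 (minLabel_mem (ht.nonempty_of_mem_edges hU.1)))
  have hjA : j ∈ A := by grind
  have hjmin : j ≠ minLabel A := by
    have := minLabel_le hi
    have := minLabel_le haA
    omega
  have hpair : ∀ E₁ ∈ t, ∀ E₂ ∈ t, E₁ ≠ E₂ → E₁.erase i = E₂.erase i →
      S ∈ t ∧ ((E₁ = P ∧ E₂ = S) ∨ (E₁ = S ∧ E₂ = P)) := by
    intro E₁ h₁ E₂ h₂ hne h
    by_cases hi₁ : i ∈ E₁ <;> by_cases hi₂ : i ∈ E₂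
    · exact absurd (by rw [← Finset.insert_erase hi₁, h, Finset.insert_erase hi₂]) hne
    · obtain ⟨rfl, rfl⟩ := ht.eq_parent_sibling hi hP hS hSne h₁ h₂ hi₁ hi₂ h
      exact ⟨h₂, Or.inl ⟨rfl, rfl⟩⟩
    · obtain ⟨rfl, rfl⟩ := ht.eq_parent_sibling hi hP hS hSne h₂ h₁ hi₂ hi₁ h.symm
      exact ⟨h₁, Or.inr ⟨rfl, rfl⟩⟩
    · rw [Finset.erase_eq_of_notMem hi₁, Finset.erase_eq_of_notMem hi₂] at h
      exact absurd h hne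
  refine ⟨⟨hjA, hjmin⟩, fun E₁ _ E₂ _ => hrel E₁ E₂, hpair, ?_, ?_⟩
  · intro E₁ h₁ E₂ h₂ h
    obtain ⟨hP₁, h₁⟩ := Finset.mem_erase.1 (Finset.mem_coe.1 h₁)
    obtain ⟨hP₂, h₂⟩ := Finset.mem_erase.1 (Finset.mem_coe.1 h₂)
    by_contra hne
    rcases (hpair E₁ h₁ E₂ h₂ hne ((hrel _ _).1 h)).2 with ⟨h, -⟩ | ⟨-, h⟩
    · exact hP₁ h
    · exact hP₂ h
  · have hground : A.erase j = (A.erase i).map (Equiv.swap i j).toEmbedding := by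
      ext x
      rw [Finset.mem_map_equiv, Equiv.symm_swap, Equiv.swap_apply_def]
      split_ifs <;> grind
    have := (ht.erase_leaf hi hP hS hSne).map_equiv (Equiv.swap i j)
    rw [hground, funext (relabel_eq_map_swap i j)]
    rwa [Finset.image_image] at this

end AldousTrees
end

section
/- The projection π_{−j} inverts label insertion: Let A ⊆ ℕ be finite and nonempty, T ∈ 𝕋_A, j ∈ ℕ∖A, let ℓ be a block of T (either a leaf block i ∈ A or an internal block (F,a,b)), and let U = (y_1, y_2, γ) be a 2-tree of total mass 1, i.e. y_1, y_2 ≥ 0, γ ∈ 𝓘 and y_1 + y_2 + ‖γ‖ = 1. Then π_{−j}(T ⊕ (ℓ, j, U)) = T. In particular, the resampling kernel Λ_{j,A}, which inserts label j into a block of T chosen at random, is a section of the projection π_{−j}. -/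
open scoped Classical

namespace AldousTrees

open MeasureTheory Filter Set

noncomputable section

/-! ### Interval partitions -/

/-- An interval partition is recorded as a pair `(mass, blocks)`: a real mass `M` together
with the set of (endpoint pairs of) its open interval blocks. -/
abbrev IP : Type := ℝ × Set (ℝ × ℝ)

/-- The trivial (empty) interval partition. -/
def IP.zero : IP := (0, ∅)

/-- `β` is an interval partition of `[0, β.1]`: its blocks are disjoint nonempty open
subintervals of `[0, β.1]` covering `[0, β.1]` up to a Lebesgue-null set. -/
def IsIntervalPartition (β : IP) : Prop :=
  0 ≤ β.1 ∧
  (∀ p ∈ β.2, 0 ≤ p.1 ∧ p.1 < p.2 ∧ p.2 ≤ β.1) ∧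
  (β.2.Pairwise fun p q => Disjoint (Ioo p.1 p.2) (Ioo q.1 q.2)) ∧
  volume (Icc (0 : ℝ) β.1 \ ⋃ p ∈ β.2, Ioo p.1 p.2) = 0

/-- `𝒟_β(t) = d`: the ½-diversity of `β` up to the point `t` exists and equals `d`, i.e.
`√π · √h · #{(a,b) ∈ β : b − a > h, b < t} → d` as `h ↓ 0`. -/
def HasDiversity (β : IP) (t d : ℝ) : Prop :=
  Tendsto
    (fun h : ℝ => Real.sqrt Real.pi * Real.sqrt h *
      ({p : ℝ × ℝ | p ∈ β.2 ∧ h < p.2 - p.1 ∧ p.2 < t}.ncard : ℝ))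
    (nhdsWithin 0 (Ioi 0)) (nhds d)

/-- `𝒟_β(∞) = d`: the total ½-diversity of `β` exists and equals `d`. -/
def HasTotalDiversity (β : IP) (d : ℝ) : Prop :=
  Tendsto
    (fun h : ℝ => Real.sqrt Real.pi * Real.sqrt h *
      ({p : ℝ × ℝ | p ∈ β.2 ∧ h < p.2 - p.1}.ncard : ℝ))
    (nhdsWithin 0 (Ioi 0)) (nhds d)

/-- `β ∈ 𝓘`: `β` is an interval partition with the ½-diversity property. -/
def MemIcal (β : IP) : Prop :=
  IsIntervalPartition β ∧ ∀ t : ℝ, 0 ≤ t → ∃ d, HasDiversity β t d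

/-- Concatenation `α ⋆ β` of interval partitions. -/
def IP.concat (α β : IP) : IP :=
  (α.1 + β.1, α.2 ∪ (fun p : ℝ × ℝ => (α.1 + p.1, α.1 + p.2)) '' β.2)

/-- The interval partition `(0,x)` consisting of a single block of mass `x > 0`
(empty if `x = 0`). -/
def IP.single (x : ℝ) : IP := (x, if 0 < x then {((0 : ℝ), x)} else ∅)

/-- The interval partition `β` scaled by `c`. -/
def IP.scale (c : ℝ) (β : IP) : IP :=
  (c * β.1, (fun p : ℝ × ℝ => (c * p.1, c * p.2)) '' β.2)

/-- The part of `β` strictly to the left of the block `(a,b)` (an interval partition of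
`[0,a]`). -/
def IP.before (β : IP) (a : ℝ) : IP := (a, {p ∈ β.2 | p.2 ≤ a})

/-- The part of `β` strictly to the right of the block `(a,b)`, shifted to start at `0`. -/
def IP.after (β : IP) (b : ℝ) : IP :=
  (β.1 - b, (fun p : ℝ × ℝ => (p.1 - b, p.2 - b)) '' {p ∈ β.2 | b ≤ p.1})

/-! ### A-trees -/

/-- An `A`-tree: a tree shape together with top masses on the leaves and interval partitions
on the internal edges.  `top` and `part` are total functions; membership in `𝕋_A` requires
them to vanish off the label set/shape. -/
structure ATree : Type where
  shape : Finset (Finset ℕ)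
  top : ℕ → ℝ
  part : Finset ℕ → IP

/-- The parent edge `parent(E) = ⋂ {F ∈ t : E ⊊ F}` of `E` (computed inside the ground set
`⋃ t`; it equals `⋃ t` if no edge strictly contains `E`). -/
def parentEdge (t : Finset (Finset ℕ)) (E : Finset ℕ) : Finset ℕ :=
  (t.sup id).filter fun x => ∀ F ∈ t, E ⊂ F → x ∈ F

/-- Label `i` is degenerate in `T`: `x_i + ‖β_{parent({i})}‖ = 0`. -/
def Degenerate (T : ATree) (i : ℕ) : Prop :=
  T.top i + (T.part (parentEdge T.shape {i})).1 = 0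

/-- The basic requirements for `T` to be an `A`-tree: the shape is a tree shape on `A`, top
masses are nonnegative (and vanish off `A`), edge partitions lie in `𝓘` (and are trivial off
the shape), and `x_i + x_j > 0` for every type-2 edge `{i,j}`. -/
def PreTree (A : Finset ℕ) (T : ATree) : Prop :=
  IsTreeShape A T.shape ∧
  (∀ i ∈ A, 0 ≤ T.top i) ∧ (∀ i, i ∉ A → T.top i = 0) ∧
  (∀ E ∈ T.shape, MemIcal (T.part E)) ∧ (∀ E, E ∉ T.shape → T.part E = IP.zero) ∧
  (∀ E ∈ T.shape, E.card = 2 → 0 < ∑ i ∈ E, T.top i)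

/-- `T ∈ 𝕋_A`: an `A`-tree with no degenerate label. -/
def MemT (A : Finset ℕ) (T : ATree) : Prop :=
  PreTree A T ∧ ∀ i ∈ A, ¬ Degenerate T i

/-- `T ∈ 𝕋̃_A`: an `A`-tree with at most one degenerate label. -/
def MemTtilde (A : Finset ℕ) (T : ATree) : Prop :=
  PreTree A T ∧ ∀ i ∈ A, ∀ i' ∈ A, Degenerate T i → Degenerate T i' → i = i'

/-- The projection `π_{−j}` removing label `j` from an `A`-tree.  If `parent({j})` is a
type-2 edge `{a,j}`, the whole compound is absorbed into the top mass of `a`; otherwise the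
partitions of the sibling edge, the block `(0,x_j)` and the parent edge are concatenated onto
the sibling edge `parent({j}) ∖ {j}`; all other components are carried over along
`E ↦ E ∖ {j}`. -/
def proj (j : ℕ) (T : ATree) : ATree :=
  letI P := parentEdge T.shape {j}
  letI t' := (T.shape.erase P).image fun E => E.erase j
  { shape := t'
    top := fun i =>
      if i = j then 0
      else if P.card = 2 ∧ i ∈ P then T.top i + T.top j + (T.part P).1
      else T.top i
    part := fun F =>
      if F ∈ t' then
        if P.card ≠ 2 ∧ F = P.erase j then
          IP.concat (IP.concat (T.part (P.erase j)) (IP.single (T.top j))) (T.part P)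
        else if insert j F ∈ T.shape ∧ insert j F ≠ P then T.part (insert j F)
        else T.part F
      else IP.zero }

end

end AldousTrees

namespace AldousTrees

noncomputable section

/-- A block of an `A`-tree: either a leaf block `i ∈ A`, or an internal block `(F,a,b)`
given by a block `(a,b)` of the interval partition on the internal edge `F`. -/
inductive Block : Type
  | leaf (i : ℕ) : Block
  | int (F : Finset ℕ) (a b : ℝ) : Block

/-- `ℓ` is a block of the `A`-tree `T`. -/
def IsBlockOf (A : Finset ℕ) (T : ATree) : Block → Prop
  | Block.leaf i => i ∈ A
  | Block.int F a b => F ∈ T.shape ∧ (a, b) ∈ (T.part F).2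

/-- A 2-tree `U = (y₁, y₂, γ)` of total mass 1. -/
def IsUnit2Tree (U : ℝ × ℝ × IP) : Prop :=
  0 ≤ U.1 ∧ 0 ≤ U.2.1 ∧ MemIcal U.2.2 ∧ U.1 + U.2.1 + U.2.2.1 = 1

/-- Insertion of a new leaf `j` into the edge `F` of the tree shape `t`. -/
def insertShape (t : Finset (Finset ℕ)) (F : Finset ℕ) (j : ℕ) : Finset (Finset ℕ) :=
  (t.image fun E => if F ⊂ E then insert j E else E) ∪ {insert j F}

/-- The label insertion operator `T ⊕ (ℓ, j, U)`, inserting a new label `j` into the block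
`ℓ` of `T`.  If `ℓ = i` is a leaf block, the block is replaced by the 2-tree `U` scaled by
`x_i`: the new top masses of `i` and `j` are `x_i y₁` and `x_i y₂` and the new edge `{i,j}`
carries `x_i γ`.  If `ℓ = (F,a,b)` is an internal block, writing
`β_F = β_{F,0} ⋆ (0,b−a) ⋆ β_{F,1}` with `‖β_{F,0}‖ = a`, edge `F` keeps `β_{F,0}`, the new
leaf `j` gets top mass `b − a`, and the new edge `F ∪ {j}` carries `β_{F,1}` (here `U` is
not used). -/
def insertTree (T : ATree) (ℓ : Block) (j : ℕ) (U : ℝ × ℝ × IP) : ATree :=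
  match ℓ with
  | Block.leaf i =>
    letI t' := insertShape T.shape {i} j
    { shape := t'
      top := fun m =>
        if m = i then T.top i * U.1
        else if m = j then T.top i * U.2.1
        else T.top m
      part := fun F =>
        if F ∈ t' then
          if F = insert j {i} then IP.scale (T.top i) U.2.2
          else if j ∈ F then T.part (F.erase j)
          else T.part F
        else IP.zero }
  | Block.int F₀ a b =>
    letI t' := insertShape T.shape F₀ j
    { shape := t'
      top := fun m => if m = j then b - a else T.top m
      part := fun F =>
        if F ∈ t' then
          if F = F₀ then IP.before (T.part F₀) a
          else if F = insert j F₀ then IP.after (T.part F₀) b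
          else if j ∈ F then T.part (F.erase j)
          else T.part F
        else IP.zero }

end

end AldousTrees

namespace AldousTrees

/-- Membership in the tree shape obtained by inserting the leaf `j` into the edge `G`. -/
theorem mem_insertShape {t : Finset (Finset ℕ)} {G F : Finset ℕ} {j : ℕ} :
    F ∈ insertShape t G j ↔
      (∃ E ∈ t, (G ⊂ E ∧ F = insert j E) ∨ (¬ G ⊂ E ∧ F = E)) ∨ F = insert j G := by
  simp only [insertShape, Finset.mem_union, Finset.mem_image, Finset.mem_singleton]
  refine or_congr_left (exists_congr fun E => and_congr_right fun _ => ?_)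
  by_cases h : G ⊂ E <;> simp [h, eq_comm]

theorem eq_of_insert_eq_insert {E F : Finset ℕ} {j : ℕ} (hE : j ∉ E) (hF : j ∉ F)
    (h : insert j E = insert j F) : E = F := by
  rw [← Finset.erase_insert hE, h, Finset.erase_insert hF]

theorem mem_insertShape_of_notMem {t : Finset (Finset ℕ)} {G F : Finset ℕ} {j : ℕ}
    (hF : j ∉ F) : F ∈ insertShape t G j ↔ F ∈ t ∧ ¬ G ⊂ F := by
  rw [mem_insertShape]
  constructor
  · rintro (⟨E, hE, ⟨-, rfl⟩ | ⟨h, rfl⟩⟩ | rfl)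
    · exact absurd (Finset.mem_insert_self _ _) hF
    · exact ⟨hE, h⟩
    · exact absurd (Finset.mem_insert_self _ _) hF
  · rintro ⟨h, h'⟩
    exact Or.inl ⟨F, h, Or.inr ⟨h', rfl⟩⟩

theorem insert_mem_insertShape {t : Finset (Finset ℕ)} {G F : Finset ℕ} {j : ℕ}
    (ht : ∀ E ∈ t, j ∉ E) (hG : j ∉ G) (hF : j ∉ F) :
    insert j F ∈ insertShape t G j ↔ (F ∈ t ∧ G ⊂ F) ∨ F = G := by
  rw [mem_insertShape]
  constructor
  · rintro (⟨E, hE, ⟨h, h'⟩ | ⟨-, h'⟩⟩ | h)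
    · obtain rfl := eq_of_insert_eq_insert hF (ht E hE) h'
      exact Or.inl ⟨hE, h⟩
    · exact absurd (h' ▸ Finset.mem_insert_self _ _) (ht E hE)
    · exact Or.inr (eq_of_insert_eq_insert hF hG h)
  · rintro (⟨h, h'⟩ | rfl)
    · exact Or.inl ⟨F, h, Or.inl ⟨h', rfl⟩⟩
    · exact Or.inr rfl

/-- The parent of the inserted leaf is the inserted edge. -/
theorem parentEdge_insertShape {t : Finset (Finset ℕ)} {G : Finset ℕ} {j : ℕ}
    (ht : ∀ E ∈ t, j ∉ E) (hG : j ∉ G) (hne : G.Nonempty) :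
    parentEdge (insertShape t G j) {j} = insert j G := by
  have hmem : insert j G ∈ insertShape t G j :=
    (insert_mem_insertShape ht hG hG).2 (Or.inr rfl)
  have hss : ({j} : Finset ℕ) ⊂ insert j G := by
    rw [Finset.ssubset_iff_of_subset (by simp)]
    obtain ⟨g, hg⟩ := hne
    exact ⟨g, Finset.mem_insert_of_mem hg, fun h => hG (Finset.mem_singleton.1 h ▸ hg)⟩
  ext x
  simp only [parentEdge, Finset.mem_filter]
  constructor
  · exact fun h => h.2 _ hmem hss
  · intro hx
    refine ⟨Finset.mem_sup.2 ⟨_, hmem, hx⟩, fun F hF hjF => ?_⟩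
    rcases mem_insertShape.1 hF with ⟨E, hE, ⟨h, rfl⟩ | ⟨-, rfl⟩⟩ | rfl
    · exact Finset.insert_subset_insert j h.subset hx
    · exact absurd (hjF.subset (Finset.mem_singleton_self j)) (ht _ hE)
    · exact hx

/-- Removing the inserted leaf from the tree shape recovers the original tree shape. -/
theorem image_erase_insertShape {t : Finset (Finset ℕ)} {G : Finset ℕ} {j : ℕ}
    (ht : ∀ E ∈ t, j ∉ E) (hG : j ∉ G) :
    ((insertShape t G j).erase (insert j G)).image (fun E => E.erase j) = t := by
  ext F
  simp only [Finset.mem_image, Finset.mem_erase]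
  constructor
  · rintro ⟨E', ⟨hne, hE'⟩, rfl⟩
    rcases mem_insertShape.1 hE' with ⟨E, hE, ⟨-, rfl⟩ | ⟨-, rfl⟩⟩ | h
    · rwa [Finset.erase_insert (ht E hE)]
    · rwa [Finset.erase_eq_of_notMem (ht _ hE)]
    · exact absurd h hne
  · intro hF
    have hjF := ht F hF
    by_cases h : G ⊂ F
    · refine ⟨insert j F, ⟨fun h' => ?_, ?_⟩, Finset.erase_insert hjF⟩
      · exact h.ne (eq_of_insert_eq_insert hjF hG h').symm
      · exact (insert_mem_insertShape ht hG hjF).2 (Or.inl ⟨hF, h⟩)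
    · refine ⟨F, ⟨fun h' => ?_, ?_⟩, Finset.erase_eq_of_notMem hjF⟩
      · exact hjF (h' ▸ Finset.mem_insert_self _ _)
      · exact (mem_insertShape_of_notMem hjF).2 ⟨hF, h⟩

/-- Cutting an interval partition at one of its blocks and concatenating the pieces recovers
the interval partition. -/
theorem concat_before_single_after {β : IP} (hβ : IsIntervalPartition β) {a b : ℝ}
    (hab : (a, b) ∈ β.2) :
    IP.concat (IP.concat (IP.before β a) (IP.single (b - a))) (IP.after β b) = β := by
  obtain ⟨-, hbl, hdisj, -⟩ := hβ
  have hlt : a < b := (hbl _ hab).2.1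
  refine Prod.ext ?_ ?_
  · simp [IP.concat, IP.before, IP.single, IP.after]
  · ext ⟨c, d⟩
    simp only [IP.concat, IP.before, IP.single, IP.after, sub_pos, hlt, if_true,
      Set.image_singleton, Set.mem_union, Set.mem_image, Set.mem_singleton_iff, Set.mem_ofPred_eq,
      Prod.exists, Prod.mk.injEq, add_zero, add_sub_cancel]
    constructor
    · rintro ((h | ⟨rfl, rfl⟩) | ⟨_, _, ⟨p, q, ⟨hpq, -⟩, rfl, rfl⟩, rfl, rfl⟩)
      · exact h.1
      · exact hab
      · simpa using hpq
    · intro h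
      by_cases heq : (c, d) = (a, b)
      · exact Or.inl (Or.inr (Prod.mk.inj heq))
      have hcd : c < d := (hbl _ h).2.1
      have hmin : min d b ≤ max c a := by
        have : Disjoint (Set.Ioo c d) (Set.Ioo a b) := hdisj h hab heq
        rwa [Set.Ioo_disjoint_Ioo] at this
      by_cases hda : d ≤ a
      · exact Or.inl (Or.inl ⟨h, hda⟩)
      · have hbc : b ≤ c := by
          rcases min_le_iff.1 hmin with h1 | h1 <;> rcases le_max_iff.1 h1 with h2 | h2 <;>
            linarith
        exact Or.inr ⟨c - b, d - b, ⟨c, d, ⟨h, hbc⟩, rfl, rfl⟩, by ring, by ring⟩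

/-- Componentwise criterion for `T` to be the projection of a tree whose shape is obtained
by inserting the leaf `j` into the edge `G` of the shape of `T`. -/
theorem proj_eq_of_shape_eq_insertShape {T T' : ATree} {G : Finset ℕ} {j : ℕ}
    (ht : ∀ E ∈ T.shape, j ∉ E) (hG : j ∉ G) (hne : G.Nonempty)
    (hshape : T'.shape = insertShape T.shape G j)
    (htop : ∀ i, (if i = j then 0
      else if (insert j G).card = 2 ∧ i ∈ insert j G then
        T'.top i + T'.top j + (T'.part (insert j G)).1
      else T'.top i) = T.top i)
    (hzero : ∀ F, F ∉ T.shape → T.part F = IP.zero)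
    (hlow : (insert j G).card ≠ 2 →
      IP.concat (IP.concat (T'.part G) (IP.single (T'.top j))) (T'.part (insert j G)) = T.part G)
    (habove : ∀ F ∈ T.shape, G ⊂ F → T'.part (insert j F) = T.part F)
    (hother : ∀ F ∈ T.shape, ¬ G ⊂ F → (F = G → (insert j G).card = 2) →
      T'.part F = T.part F) :
    proj j T' = T := by
  obtain ⟨t, x, β⟩ := T
  simp only at ht htop hzero hlow habove hother hshape
  simp only [proj, hshape, parentEdge_insertShape ht hG hne, image_erase_insertShape ht hG,
    Finset.erase_insert hG, ATree.mk.injEq, true_and]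
  refine ⟨funext fun i => ?_, funext fun F => ?_⟩
  · exact htop i
  by_cases hF : F ∈ t
  swap
  · rw [if_neg hF, hzero F hF]
  rw [if_pos hF]
  by_cases h : (insert j G).card ≠ 2 ∧ F = G
  · rw [if_pos h, h.2, hlow h.1]
  rw [if_neg h]
  by_cases hGF : G ⊂ F
  · rw [if_pos, habove F hF hGF]
    exact ⟨(insert_mem_insertShape ht hG (ht F hF)).2 (Or.inl ⟨hF, hGF⟩),
      fun h' => hGF.ne (eq_of_insert_eq_insert (ht F hF) hG h').symm⟩
  · rw [if_neg, hother F hF hGF]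
    · exact fun hFG => not_not.1 fun hc => h ⟨hc, hFG⟩
    · rintro ⟨h1, h2⟩
      rcases (insert_mem_insertShape ht hG (ht F hF)).1 h1 with h3 | rfl
      · exact hGF h3.2
      · exact h2 rfl

/-- **The projection `π_{−j}` inverts label insertion.**  For `T ∈ 𝕋_A`, `j ∉ A`, any block
`ℓ` of `T` and any 2-tree `U` of total mass 1, one has `π_{−j}(T ⊕ (ℓ, j, U)) = T`.  (In
particular the resampling kernel `Λ_{j,A}`, which inserts label `j` into a randomly chosen
block, is a section of `π_{−j}`.) -/
theorem proj_insertTree (A : Finset ℕ) (T : ATree) (hT : MemT A T)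
    (j : ℕ) (hj : j ∉ A) (ℓ : Block) (hℓ : IsBlockOf A T ℓ)
    (U : ℝ × ℝ × IP) (hU : IsUnit2Tree U) :
    proj j (insertTree T ℓ j U) = T := by
  obtain ⟨⟨hshape, -, htop, hpart, hzero, -⟩, -⟩ := hT
  have ht : ∀ E ∈ T.shape, j ∉ E := fun E hE h => hj (hshape.subset_ground E hE h)
  have hne (E : Finset ℕ) {F : Finset ℕ} (hF : F ∈ T.shape) : F ≠ insert j E :=
    fun h => ht F hF (h ▸ Finset.mem_insert_self _ _)
  cases ℓ with
  | leaf i =>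
    have hi : i ∈ A := hℓ
    have hij : i ≠ j := fun h => hj (h ▸ hi)
    have hG : j ∉ ({i} : Finset ℕ) := fun h => hij (Finset.mem_singleton.1 h).symm
    have hcard : (insert j ({i} : Finset ℕ)).card = 2 := by
      rw [Finset.card_insert_of_notMem hG, Finset.card_singleton]
    refine proj_eq_of_shape_eq_insertShape ht hG (Finset.singleton_nonempty i) rfl ?_ hzero
      (fun h => absurd hcard h) ?_ ?_
    · intro m
      have hmem := (insert_mem_insertShape ht hG hG).2 (Or.inr rfl)
      by_cases hmj : m = j
      · rw [if_pos hmj, hmj, htop j hj]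
      by_cases hmi : m = i
      · subst hmi
        simp only [insertTree, hmj, Ne.symm hmj, hcard, hmem, if_true, if_false, IP.scale,
          Finset.mem_insert, Finset.mem_singleton, or_true, and_self]
        rw [← mul_add, ← mul_add, hU.2.2.2, mul_one]
      · simp [insertTree, hmj, hmi]
    · intro F hF hGF
      have h1 := (insert_mem_insertShape ht hG (ht F hF)).2 (Or.inl ⟨hF, hGF⟩)
      have h2 : insert j F ≠ insert j {i} :=
        fun h => hGF.ne (eq_of_insert_eq_insert (ht F hF) hG h).symm
      simp only [insertTree, if_pos h1, if_neg h2, if_pos (Finset.mem_insert_self j F),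
        Finset.erase_insert (ht F hF)]
    · intro F hF hGF _
      have h1 := (mem_insertShape_of_notMem (ht F hF)).2 ⟨hF, hGF⟩
      simp only [insertTree, if_pos h1, if_neg (hne {i} hF), if_neg (ht F hF)]
  | int G a b =>
    obtain ⟨hGt, hab⟩ := hℓ
    have hG : j ∉ G := ht G hGt
    have hGcard : 2 ≤ G.card := hshape.two_le_card G hGt
    have hcard : (insert j G).card ≠ 2 := by
      rw [Finset.card_insert_of_notMem hG]
      omega
    refine proj_eq_of_shape_eq_insertShape ht hG (Finset.card_pos.1 (by omega)) rfl ?_ hzero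
      ?_ ?_ ?_
    · intro m
      by_cases hmj : m = j
      · rw [if_pos hmj, hmj, htop j hj]
      · rw [if_neg hmj, if_neg (fun h => hcard h.1)]
        simp only [insertTree, if_neg hmj]
    · intro _
      have h1 := (mem_insertShape_of_notMem hG).2 ⟨hGt, ssubset_irrefl G⟩
      have h2 := (insert_mem_insertShape ht hG hG).2 (Or.inr rfl)
      simp only [insertTree, if_pos h1, if_pos h2, if_neg (hne G hGt).symm, if_true]
      exact concat_before_single_after (hpart G hGt).1 hab
    · intro F hF hGF
      have h1 := (insert_mem_insertShape ht hG (ht F hF)).2 (Or.inl ⟨hF, hGF⟩)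
      have h2 : insert j F ≠ insert j G :=
        fun h => hGF.ne (eq_of_insert_eq_insert (ht F hF) hG h).symm
      simp only [insertTree, if_pos h1, if_neg h2, if_neg (hne F hGt).symm,
        if_pos (Finset.mem_insert_self j F), Finset.erase_insert (ht F hF)]
    · intro F hF hGF hFG
      have h1 := (mem_insertShape_of_notMem (ht F hF)).2 ⟨hF, hGF⟩
      have h2 : F ≠ G := fun h => hcard (hFG h)
      simp only [insertTree, if_pos h1, if_neg h2, if_neg (hne G hF), if_neg (ht F hF)]

end AldousTrees
end
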